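/- For every ε ∈ (0, 1/2) there exist c = c(ε) > 0 and x₀ = x₀(ε) such that the following holds for all x ≥ x₀. Let r be an integer with (1+ε)·Log₂ x ≤ r ≤ (2−ε)·Log₂ x and set α := r/Log₂ x − 1. Then ∏_{p < x}(1 + 1/p)^{-1} · ∑_{n ∈ S_{<x}, ω(n) = r} (1/n) · max_{y ∈ 𝒴} (τ(n_{<y})/Log y) ≥ c. -/

import Mathlib

open Filter Topology
open scoped Classical

noncomputable def LLog (x : ℝ) : ℝ := max 1 (Real.log x)
noncomputable def LLog2 (x : ℝ) : ℝ := LLog (LLog x)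
noncomputable def LLog3 (x : ℝ) : ℝ := LLog (LLog2 x)

/-- `Δ^{(v)}(n)`: the maximal number of divisors of `n` in an interval `(e^u, e^{u+v}]`. -/
noncomputable def DeltaV (v : ℝ) (n : ℕ) : ℕ :=
  ⨆ u : ℝ, (n.divisors.filter fun d => Real.exp u < (d : ℝ) ∧ (d : ℝ) ≤ Real.exp (u + v)).card

/-- The Erdős–Hooley Delta function. -/
noncomputable def Delta (n : ℕ) : ℕ := DeltaV 1 n

/-- `S_{[y,x)}`: squarefree positive integers all of whose prime factors `p` satisfy `y ≤ p < x`. -/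
def Sset (y x : ℝ) : Set ℕ :=
  {n | 0 < n ∧ Squarefree n ∧ ∀ p ∈ n.primeFactors, y ≤ (p : ℝ) ∧ (p : ℝ) < x}

/-- `∏_{y ≤ p < x} (1 + 1/p)⁻¹`, product over primes. -/
noncomputable def primeProd (y x : ℝ) : ℝ :=
  ∏ᶠ p ∈ {p : ℕ | p.Prime ∧ y ≤ (p : ℝ) ∧ (p : ℝ) < x}, ((1 : ℝ) + 1 / p)⁻¹

/-- number of distinct prime factors -/
def omegaN (n : ℕ) : ℕ := n.primeFactors.card

/-- number of divisors -/
def tauN (n : ℕ) : ℕ := n.divisors.card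

/-- `n_{<y}`: the largest divisor of `n` (squarefree) composed of primes `< y`. -/
noncomputable def nsmall (n : ℕ) (y : ℝ) : ℕ :=
  ∏ p ∈ n.primeFactors.filter (fun p : ℕ => (p : ℝ) < y), p

def Yset (α x : ℝ) : Set ℝ :=
  {y | 0 < y ∧ |LLog2 y - α * LLog2 x| ≤ Real.sqrt (LLog2 x) ∧ ∃ m : ℤ, LLog2 y = m * Real.log 2}

def Uset (α x : ℝ) : Set ℤ :=
  {u | |(u : ℝ) - (Real.log 4 - 1) / Real.log 2 * (α * LLog2 x)| ≤ Real.sqrt (LLog2 x)}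

noncomputable def Qfun (t : ℝ) : ℝ := t * Real.log t - t + 1


lemma log_fact_eq (N : ℕ) : Real.log (N.factorial : ℝ) =
    ∑ p ∈ (Finset.range (N+1)).filter Nat.Prime, (padicValNat p N.factorial : ℝ) * Real.log p := by
  rw [Real.log_nat_eq_sum_factorization, Finsupp.sum]
  have : N.factorial.factorization.support ⊆ (Finset.range (N+1)).filter Nat.Prime := by
    intro p hp
    simp only [Nat.support_factorization, Nat.mem_primeFactors] at hp
    simp only [Finset.mem_filter, Finset.mem_range]
    exact ⟨Nat.lt_succ_of_le ((Nat.Prime.dvd_factorial hp.1).1 hp.2.1), hp.1⟩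
  rw [Finset.sum_subset this]
  · apply Finset.sum_congr rfl
    intro p hp
    rw [Nat.factorization_def _ (Finset.mem_filter.1 hp).2]
  · intro p _ h
    rw [Finsupp.notMem_support_iff] at h
    simp [h]

lemma padic_fact_ge (N p : ℕ) (hp : p.Prime) : (N : ℝ) / p - 1 ≤ (padicValNat p N.factorial : ℝ) := by
  haveI := Fact.mk hp
  have h1 : N / p ≤ padicValNat p N.factorial := by
    rw [padicValNat_factorial (b := Nat.log p N + 2) (by omega)]
    calc N / p = N / p ^ 1 := by simp
      _ ≤ _ := Finset.single_le_sum (f := fun i => N / p ^ i) (fun _ _ => Nat.zero_le _) (by simp)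
  have h2 : (N : ℝ) / p < (N / p : ℕ) + 1 := by
    rw [div_lt_iff₀ (by exact_mod_cast hp.pos)]
    have := Nat.lt_div_mul_add (a := N) hp.pos
    have h3 : N < (N / p + 1) * p := by linarith
    exact_mod_cast h3
  have h3 : ((N / p : ℕ) : ℝ) ≤ (padicValNat p N.factorial : ℝ) := by exact_mod_cast h1
  linarith

lemma padic_fact_le (N p : ℕ) (hp : p.Prime) : (padicValNat p N.factorial : ℝ) ≤ (N : ℝ) / p + N * (2 / p ^ 2) := by
  haveI := Fact.mk hp
  have h1 : (p - 1) * padicValNat p N.factorial ≤ N := by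
    rw [sub_one_mul_padicValNat_factorial]; omega
  have hp2 : (2:ℝ) ≤ p := by exact_mod_cast hp.two_le
  have h2 : ((p:ℝ) - 1) * padicValNat p N.factorial ≤ N := by
    have : ((p - 1 : ℕ) : ℝ) * padicValNat p N.factorial ≤ N := by exact_mod_cast h1
    rwa [Nat.cast_sub hp.one_le, Nat.cast_one] at this
  have h3 : (padicValNat p N.factorial : ℝ) ≤ N / (p - 1) := by
    rw [le_div_iff₀ (by linarith)]; linarith
  refine h3.trans ?_
  have h4 : (1:ℝ) / (p - 1) ≤ 1 / p + 2 / p ^ 2 := by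
    rw [div_add_div _ _ (by positivity) (by positivity), div_le_div_iff₀ (by linarith) (by positivity)]
    nlinarith [mul_nonneg (by linarith : (0:ℝ) ≤ p) (by linarith : (0:ℝ) ≤ p - 2)]
  have : (N:ℝ) / (p - 1) = N * (1 / (p - 1)) := by ring
  rw [this]
  calc (N:ℝ) * (1 / (p - 1)) ≤ N * (1 / p + 2 / p ^ 2) := by gcongr
    _ = _ := by ring

lemma sum_log_sq_bdd : ∃ C : ℝ, 0 ≤ C ∧ ∀ s : Finset ℕ, ∑ p ∈ s, 2 / (p:ℝ) ^ 2 * Real.log p ≤ C := by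
  have hs : Summable (fun n : ℕ => 4 * (1 / (n:ℝ) ^ (3/2 : ℝ))) :=
    (Real.summable_one_div_nat_rpow.2 (by norm_num)).mul_left _
  refine ⟨∑' n : ℕ, 4 * (1 / (n:ℝ) ^ (3/2 : ℝ)), tsum_nonneg (fun n => by positivity), fun s => ?_⟩
  refine le_trans (Finset.sum_le_sum fun p _ => ?_) (hs.sum_le_tsum s (fun n _ => by positivity))
  rcases Nat.eq_zero_or_pos p with rfl | hp
  · simp
  have hp' : (0:ℝ) < p := by exact_mod_cast hp
  have h1 := Real.log_le_rpow_div hp'.le (show (0:ℝ) < 1/2 by norm_num)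
  have h2 : (p:ℝ) ^ (2:ℕ) = (p:ℝ) ^ (3/2:ℝ) * (p:ℝ) ^ (1/2:ℝ) := by
    rw [← Real.rpow_add hp', ← Real.rpow_natCast]; norm_num
  calc 2 / (p:ℝ) ^ 2 * Real.log p ≤ 2 / (p:ℝ) ^ 2 * ((p:ℝ) ^ (1/2:ℝ) / (1/2)) := by gcongr
    _ = _ := by rw [h2]; field_simp; norm_num

/-- partial sums of log p / p -/
noncomputable def Amer (N : ℕ) : ℝ := ∑ p ∈ (Finset.range (N+1)).filter Nat.Prime, Real.log p / p
noncomputable def Pmer (N : ℕ) : ℝ := ∑ p ∈ (Finset.range (N+1)).filter Nat.Prime, (1:ℝ) / p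

lemma mertens1 : ∃ C : ℝ, 0 ≤ C ∧ ∀ N : ℕ, 1 ≤ N → |Amer N - Real.log N| ≤ C := by
  obtain ⟨C, hC, h⟩ := sum_log_sq_bdd
  have h4 : 0 ≤ Real.log 4 := Real.log_nonneg (by norm_num)
  refine ⟨C + 1 + Real.log 4, by positivity, fun N hN => ?_⟩
  have hN' : (0:ℝ) < N := by exact_mod_cast hN
  have hth : ∑ p ∈ (Finset.range (N+1)).filter Nat.Prime, Real.log p ≤ Real.log 4 * N := by
    have := Chebyshev.theta_le_log4_mul_x (x := N) hN'.le
    rw [Chebyshev.theta_eq_sum_Icc, Nat.floor_natCast] at this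
    convert this using 3
    ext; simp
  have hlogp : ∀ p : ℕ, p ∈ (Finset.range (N+1)).filter Nat.Prime → 0 ≤ Real.log p := fun p _ => Real.log_natCast_nonneg p
  have up : N * Amer N - Real.log 4 * N ≤ Real.log (N.factorial : ℝ) := by
    rw [log_fact_eq]
    refine le_trans ?_ (Finset.sum_le_sum fun p hp => mul_le_mul_of_nonneg_right (padic_fact_ge N p (Finset.mem_filter.1 hp).2) (hlogp p hp))
    refine le_trans (sub_le_sub_left hth _) ?_
    rw [Amer, Finset.mul_sum, ← Finset.sum_sub_distrib]
    apply le_of_eq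
    apply Finset.sum_congr rfl
    intro p _; ring
  have lo : Real.log (N.factorial : ℝ) ≤ N * Amer N + N * C := by
    rw [log_fact_eq]
    refine le_trans (Finset.sum_le_sum fun p hp => mul_le_mul_of_nonneg_right (padic_fact_le N p (Finset.mem_filter.1 hp).2) (hlogp p hp)) ?_
    refine le_trans ?_ (add_le_add_right (mul_le_mul_of_nonneg_left (h ((Finset.range (N+1)).filter Nat.Prime)) hN'.le) _)
    rw [Amer, Finset.mul_sum, Finset.mul_sum, ← Finset.sum_add_distrib]
    apply le_of_eq
    apply Finset.sum_congr rfl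
    intro p _; ring
  have f1 : Real.log (N.factorial : ℝ) ≤ N * Real.log N := by
    rw [← Real.log_pow]
    apply Real.log_le_log (by positivity)
    exact_mod_cast Nat.factorial_le_pow N
  have f2 : N * Real.log N - N ≤ Real.log (N.factorial : ℝ) := by
    have := Stirling.le_log_factorial_stirling (n := N) (by omega)
    have h1 : 0 ≤ Real.log N := Real.log_natCast_nonneg N
    have h2 : 0 ≤ Real.log (2 * Real.pi) := Real.log_nonneg (by linarith [Real.pi_gt_three])
    linarith
  have g1 : Amer N - Real.log N ≤ Real.log 4 := by
    refine le_of_mul_le_mul_left ?_ hN'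
    nlinarith
  have g2 : -(C + 1) ≤ Amer N - Real.log N := by
    refine le_of_mul_le_mul_left ?_ hN'
    nlinarith
  rw [abs_le]; constructor <;> linarith

lemma loglog_step (N : ℕ) (hN : 2 ≤ N) :
    (Real.log (N+1) - Real.log N) / Real.log (N+1) ≤ Real.log (Real.log (N+1)) - Real.log (Real.log N) ∧
    Real.log (Real.log (N+1)) - Real.log (Real.log N) - (1 / Real.log N - 1 / Real.log (N+1)) ≤ 
      (Real.log (N+1) - Real.log N) / Real.log (N+1) := by
  have hN' : (2:ℝ) ≤ N := by exact_mod_cast hN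
  have l1 : 0 < Real.log N := Real.log_pos (by linarith)
  have l2 : Real.log N ≤ Real.log (N+1) := Real.log_le_log (by linarith) (by linarith)
  have l3 : 0 < Real.log ((N:ℝ)+1) := by linarith
  have l4 : Real.log ((N:ℝ)+1) - Real.log N ≤ 1 := by
    rw [← Real.log_div (by linarith) (by linarith)]
    refine (Real.log_le_sub_one_of_pos (by positivity)).trans ?_
    rw [add_div, div_self (by linarith)]
    have : (1:ℝ) / N ≤ 1 := by rw [div_le_one (by linarith)]; linarith
    linarith
  constructor
  · have h := Real.one_sub_inv_le_log_of_pos (x := Real.log (N+1) / Real.log N) (by positivity)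
    rw [Real.log_div l3.ne' l1.ne', inv_div] at h
    rw [sub_div, div_self l3.ne']
    exact h
  · have h := Real.log_le_sub_one_of_pos (x := Real.log (N+1) / Real.log N) (by positivity)
    rw [Real.log_div l3.ne' l1.ne'] at h
    have e : Real.log (N+1) / Real.log N - 1 = (Real.log (N+1) - Real.log N) / Real.log N := by
      rw [sub_div, div_self l1.ne']
    have hmono : 1 / Real.log ((N:ℝ)+1) ≤ 1 / Real.log N := one_div_le_one_div_of_le l1 l2
    have k : (Real.log (N+1) - Real.log N) * (1 / Real.log N - 1 / Real.log (N+1)) ≤ 1 * (1 / Real.log N - 1 / Real.log (N+1)) :=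
      mul_le_mul_of_nonneg_right l4 (by linarith)
    have e2 : (Real.log (N+1) - Real.log N) * (1 / Real.log N - 1 / Real.log (N+1)) = (Real.log (N+1) - Real.log N) / Real.log N - (Real.log (N+1) - Real.log N) / Real.log (N+1) := by ring
    linarith

lemma Pmer_step (N : ℕ) (hN : 2 ≤ N) : Pmer (N+1) - Pmer N = (Amer (N+1) - Amer N) / Real.log (N+1) := by
  unfold Pmer Amer
  rw [Finset.range_add_one (n := N+1), Finset.filter_insert]
  have l3 : 0 < Real.log ((N:ℝ)+1) := Real.log_pos (by have : (2:ℝ) ≤ N := by exact_mod_cast hN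
                                                       linarith)
  split_ifs with h
  · rw [Finset.sum_insert (by simp), Finset.sum_insert (by simp)]
    push_cast
    field_simp
    ring
  · simp

lemma mertens2 : ∃ C : ℝ, 0 ≤ C ∧ ∀ N : ℕ, 2 ≤ N → |Pmer N - Real.log (Real.log N)| ≤ C := by
  obtain ⟨C, hC, h⟩ := mertens1
  set D : ℕ → ℝ := fun N => Amer N - Real.log N with hD
  set H : ℕ → ℝ := fun N => Pmer N - D N / Real.log N with hH
  have step : ∀ N : ℕ, 2 ≤ N → H (N+1) - H N = (Real.log (N+1) - Real.log N) / Real.log (N+1) + D N * (1 / Real.log N - 1 / Real.log (N+1)) := by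
    intro N hN
    have := Pmer_step N hN
    simp only [hH, hD]
    have e : Pmer (N+1) = Pmer N + (Amer (N+1) - Amer N) / Real.log (N+1) := by linarith
    rw [e]; push_cast; ring
  have facts : ∀ N : ℕ, 2 ≤ N → 0 ≤ 1 / Real.log (N:ℝ) - 1 / Real.log (N+1) ∧ 0 < Real.log N ∧ 1 / Real.log N ≤ 1 / Real.log 2 := by
    intro N hN
    have hN' : (2:ℝ) ≤ N := by exact_mod_cast hN
    have l1 : 0 < Real.log N := Real.log_pos (by linarith)
    have l2 : Real.log N ≤ Real.log (N+1) := Real.log_le_log (by linarith) (by linarith)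
    have l3 : Real.log 2 ≤ Real.log N := Real.log_le_log (by linarith) (by linarith)
    exact ⟨sub_nonneg.2 (one_div_le_one_div_of_le l1 l2), l1, one_div_le_one_div_of_le (Real.log_pos (by norm_num)) l3⟩
  have U : ∀ N : ℕ, 2 ≤ N → H N - Real.log (Real.log N) + C * (1 / Real.log N) ≤ H 2 - Real.log (Real.log 2) + C * (1 / Real.log 2) := by
    intro N hN
    induction N, hN using Nat.le_induction with
    | base => simp
    | succ N hN ih =>
      refine le_trans ?_ ih
      have s := step N hN
      have t := (loglog_step N hN).1
      have f := (facts N hN).1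
      have d := (abs_le.1 (h N (by omega))).2
      have := mul_le_mul_of_nonneg_right d f
      push_cast
      linarith
  have Lw : ∀ N : ℕ, 2 ≤ N → H 2 - Real.log (Real.log 2) - (C+1) * (1 / Real.log 2) ≤ H N - Real.log (Real.log N) - (C+1) * (1 / Real.log N) := by
    intro N hN
    induction N, hN using Nat.le_induction with
    | base => simp
    | succ N hN ih =>
      refine le_trans ih ?_
      have s := step N hN
      have t := (loglog_step N hN).2
      have f := (facts N hN).1
      have d := (abs_le.1 (h N (by omega))).1
      have := mul_le_mul_of_nonneg_right d f
      push_cast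
      linarith
  refine ⟨|H 2 - Real.log (Real.log 2)| + (C + 1) * (1 / Real.log 2) + C * (1 / Real.log 2), ?_, ?_⟩
  · have : 0 < Real.log 2 := Real.log_pos (by norm_num)
    positivity
  intro N hN
  have u := U N hN
  have l := Lw N hN
  obtain ⟨_, f1, f2⟩ := facts N hN
  have hd : |D N / Real.log N| ≤ C * (1 / Real.log 2) := by
    rw [abs_div, abs_of_pos f1, div_eq_mul_one_div]
    exact mul_le_mul (h N (by omega)) f2 (by positivity) hC
  have e : Pmer N = H N + D N / Real.log N := by simp [hH]
  have q : 0 ≤ 1 / Real.log (N:ℝ) := by positivity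
  have q2 : 0 ≤ C * (1 / Real.log (N:ℝ)) := by positivity
  rw [abs_le] at hd ⊢
  have a1 := le_abs_self (H 2 - Real.log (Real.log 2))
  have a2 := neg_abs_le (H 2 - Real.log (Real.log 2))
  have q3 : 0 ≤ 1 / Real.log (2:ℝ) := by linarith
  constructor
  · rw [e]; nlinarith
  · rw [e]; nlinarith

/-- primes 20 ≤ p < y -/
noncomputable def Tset (y : ℝ) : Finset ℕ := (Finset.range ⌈y⌉₊).filter (fun p => p.Prime ∧ 20 ≤ p)

noncomputable def Ssum (y : ℝ) : ℝ := ∑ p ∈ Tset y, (1:ℝ) / p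

lemma mertens3 : ∃ C : ℝ, 0 ≤ C ∧ ∀ y : ℝ, 3 ≤ y →
    |(∑ p ∈ (Finset.range ⌈y⌉₊).filter Nat.Prime, (1:ℝ) / p) - Real.log (Real.log y)| ≤ C ∧ 
    |Ssum y - Real.log (Real.log y)| ≤ C := by
  obtain ⟨C, hC, h⟩ := mertens2
  refine ⟨C + 22, by positivity, fun y hy => ?_⟩
  have hl1 : 1 ≤ Real.log y := by
    rw [Real.le_log_iff_exp_le (by linarith)]
    linarith [Real.exp_one_lt_d9]
  obtain ⟨M, hM⟩ : ∃ M, ⌈y⌉₊ = M := ⟨_, rfl⟩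
  have hM1 : y ≤ M := hM ▸ Nat.le_ceil y
  have hM2 : (M:ℝ) < y + 1 := hM ▸ Nat.ceil_lt_add_one (by linarith)
  have hM3 : 2 ≤ M := by
    have : (2:ℝ) ≤ M := by linarith
    exact_mod_cast this
  have hll1 : Real.log (Real.log y) ≤ Real.log (Real.log M) :=
    Real.log_le_log (by linarith) (Real.log_le_log (by linarith) hM1)
  have hll2 : Real.log (Real.log M) ≤ Real.log (Real.log y) + 1 := by
    have h2 : Real.log M ≤ 2 * Real.log y := by
      have : Real.log M ≤ Real.log (y ^ 2) := Real.log_le_log (by linarith) (by nlinarith)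
      rwa [Real.log_pow] at this
    have h3 : Real.log (Real.log M) ≤ Real.log (2 * Real.log y) := 
      Real.log_le_log (Real.log_pos (by linarith)) h2
    rw [Real.log_mul (by norm_num) (by linarith)] at h3
    linarith [Real.log_two_lt_d9]
  have hm := h M hM3
  set P := ∑ p ∈ (Finset.range ⌈y⌉₊).filter Nat.Prime, (1:ℝ) / p with hP
  have hPM : Pmer M - 1 ≤ P ∧ P ≤ Pmer M := by
    rw [hP, hM, Pmer, Finset.range_add_one, Finset.filter_insert]
    split_ifs with hpr
    · rw [Finset.sum_insert (by simp)]
      have h0 : (0:ℝ) ≤ 1 / M := by positivity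
      have h1 : (1:ℝ) / M ≤ 1 := by
        rw [div_le_one (by linarith)]; linarith
      constructor <;> linarith
    · constructor <;> linarith
  have hS : Ssum y ≤ P ∧ P ≤ Ssum y + 20 := by
    have e : P = Ssum y + ∑ p ∈ ((Finset.range ⌈y⌉₊).filter Nat.Prime).filter (fun p => ¬ 20 ≤ p), (1:ℝ)/p := by
      rw [hP, Ssum, Tset, ← Finset.filter_filter, Finset.sum_filter_add_sum_filter_not]
    have h0 : 0 ≤ ∑ p ∈ ((Finset.range ⌈y⌉₊).filter Nat.Prime).filter (fun p => ¬ 20 ≤ p), (1:ℝ)/p :=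
      Finset.sum_nonneg fun _ _ => by positivity
    have h1 : ∑ p ∈ ((Finset.range ⌈y⌉₊).filter Nat.Prime).filter (fun p => ¬ 20 ≤ p), (1:ℝ)/p ≤ ∑ p ∈ Finset.range 20, (1:ℝ) := by
      refine le_trans (Finset.sum_le_sum (g := fun _ => (1:ℝ)) fun p hp => ?_) (Finset.sum_le_sum_of_subset_of_nonneg ?_ (fun _ _ _ => by norm_num))
      · have : 1 ≤ p := (Finset.mem_filter.1 (Finset.mem_filter.1 hp).1).2.one_le
        have : (1:ℝ) ≤ p := by exact_mod_cast this
        rw [div_le_one (by linarith)]; exact this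
      · intro p hp
        have := (Finset.mem_filter.1 hp).2
        simp; omega
    simp at h1
    constructor
    · linarith
    · rw [e]; simp only [one_div, not_le] at h1 ⊢; linarith
  rw [abs_le] at hm
  constructor <;> rw [abs_le] <;> constructor <;> linarith


/-- elementary symmetric sums -/
noncomputable def Esym (r : ℕ) (T : Finset ℕ) (z : ℕ → ℝ) : ℝ := ∑ A ∈ T.powersetCard r, ∏ p ∈ A, z p

lemma Esym_zero (T : Finset ℕ) (z : ℕ → ℝ) : Esym 0 T z = 1 := by simp [Esym]

lemma Esym_nonneg (r : ℕ) (T : Finset ℕ) (z : ℕ → ℝ) (hz : ∀ p, 0 ≤ z p) : 0 ≤ Esym r T z :=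
  Finset.sum_nonneg fun _ _ => Finset.prod_nonneg fun _ _ => hz _

lemma Esym_insert (r : ℕ) (T : Finset ℕ) (z : ℕ → ℝ) (a : ℕ) (ha : a ∉ T) :
    Esym (r+1) (insert a T) z = Esym (r+1) T z + z a * Esym r T z := by
  unfold Esym
  rw [Finset.powersetCard_succ_insert ha, Finset.sum_union, Finset.sum_image]
  · congr 1
    rw [Finset.mul_sum]
    apply Finset.sum_congr rfl
    intro A hA
    rw [Finset.prod_insert]
    exact fun h => ha ((Finset.mem_powersetCard.1 hA).1 h)
  · intro A hA B hB hAB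
    have h1 : a ∉ A := fun h => ha ((Finset.mem_powersetCard.1 hA).1 h)
    have h2 : a ∉ B := fun h => ha ((Finset.mem_powersetCard.1 hB).1 h)
    rw [← Finset.erase_insert h1, ← Finset.erase_insert h2]
    change insert a A = insert a B at hAB
    rw [hAB]
  · rw [Finset.disjoint_left]
    intro A hA hB
    obtain ⟨B, _, rfl⟩ := Finset.mem_image.1 hB
    exact ha ((Finset.mem_powersetCard.1 hA).1 (Finset.mem_insert_self _ _))

lemma Esym_one (T : Finset ℕ) (z : ℕ → ℝ) : Esym 1 T z = ∑ p ∈ T, z p := by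
  simp [Esym, Finset.powersetCard_one]

lemma Esym_empty (r : ℕ) (z : ℕ → ℝ) : Esym (r+1) ∅ z = 0 := by
  rw [Esym, Finset.powersetCard_eq_empty.2 (by simp), Finset.sum_empty]

lemma Esym_rec_le (T : Finset ℕ) (z : ℕ → ℝ) (hz : ∀ p, 0 ≤ z p) : ∀ r : ℕ, 
    ((r:ℝ)+1) * Esym (r+1) T z ≤ (∑ p ∈ T, z p) * Esym r T z := by
  induction T using Finset.induction_on with
  | empty => intro r; simp [Esym_empty]
  | insert a T ha ih =>
    intro r
    rw [Finset.sum_insert ha, Esym_insert _ _ _ _ ha]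
    cases r with
    | zero => simp [Esym_zero, Esym_one]; linarith
    | succ r =>
      rw [Esym_insert _ _ _ _ ha]
      have h1 := ih (r+1)
      have h2 := mul_le_mul_of_nonneg_left (ih r) (hz a)
      have h3 : 0 ≤ z a ^ 2 * Esym r T z := mul_nonneg (sq_nonneg _) (Esym_nonneg _ _ _ hz)
      push_cast at *
      nlinarith

lemma Esym_rec_ge (T : Finset ℕ) (z : ℕ → ℝ) (hz : ∀ p, 0 ≤ z p) : ∀ r : ℕ, 
    (∑ p ∈ T, z p) * Esym (r+1) T z ≤ ((r:ℝ)+2) * Esym (r+2) T z + (∑ p ∈ T, z p ^ 2) * Esym r T z := by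
  induction T using Finset.induction_on with
  | empty => intro r; simp [Esym_empty]
  | insert a T ha ih =>
    intro r
    rw [Finset.sum_insert ha, Finset.sum_insert ha, Esym_insert _ _ _ _ ha, Esym_insert _ _ _ _ ha]
    cases r with
    | zero => 
      have h1 := ih 0
      simp only [Esym_zero, Esym_one, zero_add, Nat.cast_zero] at *
      nlinarith
    | succ r =>
      rw [Esym_insert _ _ _ _ ha]
      have h1 := ih (r+1)
      have h2 := mul_le_mul_of_nonneg_left (ih r) (hz a)
      have h3 : 0 ≤ z a ^ 3 * Esym r T z := mul_nonneg (pow_nonneg (hz a) _) (Esym_nonneg _ _ _ hz)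
      push_cast at *
      have e : r + 1 + 1 = r + 2 := rfl
      rw [e] at *
      nlinarith

lemma Esym_upper (T : Finset ℕ) (z : ℕ → ℝ) (hz : ∀ p, 0 ≤ z p) (r : ℕ) :
    r.factorial * Esym r T z ≤ (∑ p ∈ T, z p) ^ r := by
  induction r with
  | zero => simp [Esym_zero]
  | succ r ih =>
    have h := Esym_rec_le T z hz r
    have hZ : 0 ≤ ∑ p ∈ T, z p := Finset.sum_nonneg fun _ _ => hz _
    rw [Nat.factorial_succ, pow_succ]
    push_cast
    calc ((r:ℝ)+1) * r.factorial * Esym (r+1) T z = r.factorial * (((r:ℝ)+1) * Esym (r+1) T z) := by ring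
      _ ≤ r.factorial * ((∑ p ∈ T, z p) * Esym r T z) := by gcongr
      _ = (r.factorial * Esym r T z) * (∑ p ∈ T, z p) := by ring
      _ ≤ _ := by gcongr

lemma Esym_lower (T : Finset ℕ) (z : ℕ → ℝ) (hz : ∀ p, 0 ≤ z p) (hZ : 0 < ∑ p ∈ T, z p) (r : ℕ) :
    (∑ p ∈ T, z p) ^ r * (1 - r ^ 2 * (∑ p ∈ T, z p ^ 2) / (2 * (∑ p ∈ T, z p) ^ 2)) ≤ r.factorial * Esym r T z := by
  set Z := ∑ p ∈ T, z p with hZd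
  set Q := ∑ p ∈ T, z p ^ 2 with hQd
  have hQ : 0 ≤ Q := Finset.sum_nonneg fun _ _ => sq_nonneg _
  have key : ∀ r : ℕ, Z ^ r * (1 - (r:ℝ) * (r - 1) * Q / (2 * Z ^ 2)) ≤ r.factorial * Esym r T z := by
    intro r
    induction r with
    | zero => simp [Esym_zero]
    | succ r ih =>
      cases r with
      | zero => simp [Esym_one, ← hZd]
      | succ r =>
        have h := Esym_rec_ge T z hz r
        have u := Esym_upper T z hz r
        rw [← hZd] at h u
        rw [← hQd] at h
        have a1 : Z * ((r+1).factorial * Esym (r+1) T z) ≤ (r+2).factorial * Esym (r+2) T z + (r+1) * Q * (r.factorial * Esym r T z) := by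
          have : ((r+1).factorial:ℝ) * (Z * Esym (r+1) T z) ≤ (r+1).factorial * (((r:ℝ)+2) * Esym (r+2) T z + Q * Esym r T z) := by gcongr
          rw [Nat.factorial_succ (r+1)]
          rw [Nat.factorial_succ r] at *
          push_cast at *
          linarith
        have a2 : ((r:ℝ)+1) * Q * (r.factorial * Esym r T z) ≤ (r+1) * Q * Z ^ r := by gcongr
        have a3 := mul_le_mul_of_nonneg_left ih hZ.le
        have e : Z ^ (r+2) * (1 - ((r:ℝ)+2) * (r + 1) * Q / (2 * Z ^ 2)) = Z * (Z ^ (r+1) * (1 - ((r:ℝ)+1) * r * Q / (2 * Z^2))) - (r+1) * Q * Z ^ r := by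
          field_simp
          ring
        push_cast at a3 ⊢
        have e' : ((r:ℝ)+1+1) * (r+1+1-1) = (r+2) * (r+1) := by ring
        have e'' : ((r:ℝ)+1) * (r+1-1) = (r+1) * r := by ring
        rw [e'] 
        rw [e''] at a3
        show Z ^ (r+2) * _ ≤ ((r+2).factorial:ℝ) * Esym (r+2) T z
        rw [e]
        linarith
  refine le_trans ?_ (key r)
  have : (r:ℝ) * (r - 1) ≤ r ^ 2 := by nlinarith [Nat.cast_nonneg (α := ℝ) r]
  gcongr

lemma pow_fact_upper (Z : ℝ) (hZ : 0 ≤ Z) (r : ℕ) (hr : 1 ≤ r) :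
    Z ^ r / r.factorial ≤ Real.exp Z / √r := by
  have hr' : (0:ℝ) < r := by exact_mod_cast hr
  have h1 := Stirling.le_factorial_stirling r
  have h2 : √(r:ℝ) * (r / Real.exp 1) ^ r ≤ r.factorial := by
    refine le_trans ?_ h1
    gcongr
    nlinarith [Real.pi_gt_three]
  have h3 : (Z / r) ^ r ≤ Real.exp (Z - r) := by
    have : Z / r ≤ Real.exp (Z / r - 1) := by linarith [Real.add_one_le_exp (Z / r - 1)]
    calc (Z / r) ^ r ≤ (Real.exp (Z / r - 1)) ^ r := by gcongr
      _ = Real.exp (Z - r) := by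
        rw [← Real.exp_nat_mul]; congr 1; field_simp
  rw [div_le_div_iff₀ (by positivity) (by positivity)]
  have e : Z ^ r = (Z / r) ^ r * r ^ r := by rw [← mul_pow]; congr 1; field_simp
  have e2 : (r / Real.exp 1) ^ r = (r:ℝ) ^ r * Real.exp (-r) := by
    rw [div_pow, ← Real.exp_nat_mul, Real.exp_neg]; simp [div_eq_mul_inv]
  rw [e2] at h2
  calc Z ^ r * √r = (Z / r) ^ r * (r ^ r * √r) := by rw [e]; ring
    _ ≤ Real.exp (Z - r) * (r ^ r * √r) := by gcongr
    _ = Real.exp Z * (√(r:ℝ) * (r ^ r * Real.exp (-r))) := by rw [sub_eq_add_neg, Real.exp_add]; ring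
    _ ≤ _ := by gcongr

lemma pow_fact_lower (Z K : ℝ) (r : ℕ) (hr : 1 ≤ r) (h1 : |Z - r| ≤ r / 2) (h2 : 2 * (Z - r) ^ 2 ≤ K * r) :
    Real.exp (Z - K - 1) / √r ≤ Z ^ r / r.factorial := by
  have hr' : (0:ℝ) < r := by exact_mod_cast hr
  have s1 : (r.factorial : ℝ) ≤ Real.exp 1 * √r * (r / Real.exp 1) ^ r := by
    obtain ⟨k, rfl⟩ : ∃ k, r = k + 1 := ⟨r - 1, by omega⟩
    have h := Stirling.stirlingSeq'_antitone (Nat.zero_le k)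
    simp only [Function.comp, Nat.succ_eq_add_one, zero_add, Stirling.stirlingSeq_one] at h
    rw [Stirling.stirlingSeq, div_le_iff₀ (by positivity)] at h
    refine h.trans (le_of_eq ?_)
    rw [Real.sqrt_mul (by norm_num)]
    field_simp
  have hb := abs_le.1 h1
  have hZ : 0 < Z := by linarith
  have h3 : Real.exp (Z - r - K) ≤ (Z / r) ^ r := by
    have hpos : 0 < Z / r := by positivity
    rw [← Real.exp_log hpos, ← Real.exp_nat_mul]
    apply Real.exp_le_exp.2
    set u := Z / r - 1 with hu
    have hu1 : u * r = Z - r := by rw [hu]; field_simp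
    have hu2 : -(1/2) ≤ u := by
      rw [hu, le_sub_iff_add_le, le_div_iff₀ hr']; linarith
    have hl := Real.one_sub_inv_le_log_of_pos hpos
    have hZr : Z / r = 1 + u := by rw [hu]; ring
    have hl3 : u - 2 * u ^ 2 ≤ Real.log (Z / r) := by
      rw [hZr] at hl ⊢
      refine le_trans ?_ hl
      have hp : 0 < 1 + u := by linarith
      have e : 1 - (1 + u)⁻¹ = u / (1 + u) := by field_simp; ring
      rw [e, le_div_iff₀ hp]
      nlinarith [mul_nonneg (sq_nonneg u) (by linarith : 0 ≤ 1 + 2 * u)]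
    have hK : 2 * u ^ 2 * r ≤ K := by
      have : (2 * u ^ 2 * r) * r ≤ K * r := by
        calc (2 * u ^ 2 * r) * r = 2 * (u * r) ^ 2 := by ring
          _ ≤ _ := by rw [hu1]; exact h2
      exact le_of_mul_le_mul_right this hr'
    calc Z - r - K ≤ u * r - 2 * u ^ 2 * r := by rw [hu1]; linarith
      _ = r * (u - 2 * u ^ 2) := by ring
      _ ≤ _ := by gcongr
  rw [div_le_div_iff₀ (by positivity) (by positivity)]
  have e : Z ^ r = (Z / r) ^ r * r ^ r := by rw [← mul_pow]; congr 1; field_simp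
  have e2 : (r / Real.exp 1) ^ r = (r:ℝ) ^ r * Real.exp (-r) := by
    rw [div_pow, ← Real.exp_nat_mul, Real.exp_neg]; simp [div_eq_mul_inv]
  rw [e2] at s1
  calc Real.exp (Z - K - 1) * r.factorial ≤ Real.exp (Z - K - 1) * (Real.exp 1 * √r * ((r:ℝ) ^ r * Real.exp (-r))) := by gcongr
    _ = Real.exp (Z - r - K) * (r ^ r * √r) := by
      have : Real.exp (Z - r - K) = Real.exp (Z - K - 1) * Real.exp 1 * Real.exp (-r) := by
        rw [← Real.exp_add, ← Real.exp_add]; congr 1; ring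
      rw [this]; ring
    _ ≤ (Z / r) ^ r * (r ^ r * √r) := by gcongr
    _ = _ := by rw [e]; ring

lemma Esym_le_exp (T : Finset ℕ) (z : ℕ → ℝ) (hz : ∀ p, 0 ≤ z p) (r : ℕ) (hr : 1 ≤ r) :
    Esym r T z ≤ Real.exp (∑ p ∈ T, z p) / √r := by
  refine le_trans ?_ (pow_fact_upper _ (Finset.sum_nonneg fun _ _ => hz _) r hr)
  rw [le_div_iff₀ (by positivity), mul_comm]
  exact Esym_upper T z hz r

lemma Esym_ge_exp (T : Finset ℕ) (z : ℕ → ℝ) (hz : ∀ p, 0 ≤ z p) (r : ℕ) (hr : 1 ≤ r) (K : ℝ)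
    (hQ : ∑ p ∈ T, z p ^ 2 ≤ 1/4)
    (h1 : |(∑ p ∈ T, z p) - r| ≤ r / 2) (h2 : 2 * ((∑ p ∈ T, z p) - r) ^ 2 ≤ K * r) :
    1 / 2 * (Real.exp ((∑ p ∈ T, z p) - K - 1) / √r) ≤ Esym r T z := by
  have h := pow_fact_lower _ K r hr h1 h2
  have hr' : (0:ℝ) < r := by exact_mod_cast hr
  have hb := abs_le.1 h1
  have hZ : 0 < ∑ p ∈ T, z p := by linarith
  have hl := Esym_lower T z hz hZ r
  set Z := ∑ p ∈ T, z p
  have h3 : r ^ 2 * (∑ p ∈ T, z p ^ 2) / (2 * Z ^ 2) ≤ 1 / 2 := by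
    rw [div_le_iff₀ (by positivity)]
    have : (r:ℝ) ^ 2 ≤ 4 * Z ^ 2 := by nlinarith
    have q0 : 0 ≤ ∑ p ∈ T, z p ^ 2 := Finset.sum_nonneg fun _ _ => sq_nonneg _
    calc (r:ℝ) ^ 2 * (∑ p ∈ T, z p ^ 2) ≤ 4 * Z ^ 2 * (1/4) := by gcongr
      _ = _ := by ring
  have h4 : Z ^ r * (1 / 2) ≤ r.factorial * Esym r T z := by
    refine le_trans ?_ hl
    gcongr
    linarith
  have h5 : 1 / 2 * (Z ^ r / r.factorial) ≤ Esym r T z := by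
    rw [← mul_div_assoc, div_le_iff₀ (by positivity)]; linarith
  refine le_trans ?_ h5
  gcongr


lemma max_lin (M : Finset ℕ) (a : ℕ → ℝ) (ha : ∀ m, 0 ≤ a m) (μ : ℝ) (hμ0 : 0 ≤ μ)
    (hμ : ∀ m ∈ M, a m ^ 2 ≤ μ) (l : ℝ) (hl : 0 ≤ l) :
    2 * l * (∑ m ∈ M, a m * a m) - l ^ 2 * (∑ m ∈ M, ∑ k ∈ M, a m * a k) ≤ μ := by
  have h1 : ∑ m ∈ M, a m * a m ≤ √μ * ∑ m ∈ M, a m := by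
    rw [Finset.mul_sum]
    refine Finset.sum_le_sum fun m hm => mul_le_mul_of_nonneg_right ?_ (ha m)
    exact Real.le_sqrt_of_sq_le (hμ m hm)
  have h2 : ∑ m ∈ M, ∑ k ∈ M, a m * a k = (∑ m ∈ M, a m) ^ 2 := by
    rw [sq, Finset.sum_mul_sum]
  rw [h2]
  have h3 := mul_le_mul_of_nonneg_left h1 hl
  have h4 := Real.sq_sqrt hμ0
  nlinarith [sq_nonneg (√μ - l * ∑ m ∈ M, a m)]

lemma tau_prod (B : Finset ℕ) (hB : ∀ p ∈ B, p.Prime) : (∏ p ∈ B, p).divisors.card = 2 ^ B.card := by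
  induction B using Finset.induction_on with
  | empty => simp
  | insert a B ha ih =>
    rw [Finset.prod_insert ha, Nat.Coprime.card_divisors_mul, ih (fun p hp => hB p (Finset.mem_insert_of_mem hp)),
      Finset.card_insert_of_notMem ha, pow_succ, mul_comm]
    · congr 1
      have hp := hB a (Finset.mem_insert_self _ _)
      rw [hp.divisors, Finset.card_pair hp.one_lt.ne]
    · apply Nat.Coprime.prod_right
      intro p hp
      rw [Nat.coprime_primes (hB a (Finset.mem_insert_self _ _)) (hB p (Finset.mem_insert_of_mem hp))]
      rintro rfl; exact ha hp

noncomputable def bw (m p : ℕ) : ℝ := if (p:ℝ) < Real.exp (2 ^ m) then √2 else 1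

noncomputable def aw (A : Finset ℕ) (m : ℕ) : ℝ := (∏ p ∈ A, bw m p) / √2 ^ m

lemma bw_pos (m p : ℕ) : 0 < bw m p := by
  unfold bw; split_ifs <;> positivity

lemma aw_nonneg (A : Finset ℕ) (m : ℕ) : 0 ≤ aw A m :=
  div_nonneg (Finset.prod_nonneg fun _ _ => (bw_pos _ _).le) (by positivity)

lemma aw_sq (A : Finset ℕ) (hA : ∀ p ∈ A, p.Prime) (m : ℕ) :
    aw A m ^ 2 = (tauN (nsmall (∏ p ∈ A, p) (Real.exp (2 ^ m))) : ℝ) / 2 ^ m := by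
  rw [tauN, nsmall, Nat.primeFactors_prod hA, tau_prod _ (fun p hp => hA p (Finset.mem_filter.1 hp).1)]
  rw [aw, div_pow, ← Finset.prod_pow, ← pow_mul, mul_comm m 2, pow_mul, Real.sq_sqrt (by norm_num)]
  congr 1
  have : ∀ p, bw m p ^ 2 = if (p:ℝ) < Real.exp (2 ^ m) then 2 else 1 := by
    intro p; unfold bw; split_ifs <;> simp
  simp only [this]
  rw [Finset.prod_ite]
  simp

lemma Sset_finite (x : ℝ) : (Sset 1 x).Finite := by
  apply Set.Finite.subset (Finset.finite_toSet (∏ p ∈ (Finset.range ⌈x⌉₊).filter Nat.Prime, p).divisors)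
  rintro n ⟨hn, hsq, hp⟩
  have hne : (∏ p ∈ (Finset.range ⌈x⌉₊).filter Nat.Prime, p) ≠ 0 :=
    Finset.prod_ne_zero_iff.2 fun p hp => (Finset.mem_filter.1 hp).2.ne_zero
  rw [Finset.mem_coe, Nat.mem_divisors]
  refine ⟨?_, hne⟩
  rw [← Nat.prod_primeFactors_of_squarefree hsq]
  apply Finset.prod_dvd_prod_of_subset
  intro p h
  rw [Finset.mem_filter, Finset.mem_range, Nat.lt_ceil]
  exact ⟨(hp p h).2, Nat.prime_of_mem_primeFactors h⟩

lemma tset_mem {x : ℝ} {p : ℕ} (h : p ∈ Tset x) : p.Prime ∧ 20 ≤ p ∧ (p:ℝ) < x := by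
  rw [Tset, Finset.mem_filter, Finset.mem_range, Nat.lt_ceil] at h
  exact ⟨h.2.1, h.2.2, h.1⟩

lemma tau_nsmall_le (n : ℕ) (hn : 0 < n) (y : ℝ) : tauN (nsmall n y) ≤ tauN n := by
  unfold tauN
  apply Finset.card_le_card
  apply Nat.divisors_subset_of_dvd hn.ne'
  exact (Finset.prod_dvd_prod_of_subset _ _ _ (Finset.filter_subset _ _)).trans (Nat.prod_primeFactors_dvd n)

lemma reduction (x α : ℝ) (r : ℕ) (M : Finset ℕ)
    (hM : ∀ m ∈ M, Real.exp (2 ^ m) ∈ Yset α x ∧ LLog (Real.exp (2 ^ m)) = 2 ^ m) (l : ℝ) (hl : 0 ≤ l) :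
    ∑ A ∈ (Tset x).powersetCard r, (∏ p ∈ A, (1:ℝ) / p) *
      (2 * l * (∑ m ∈ M, aw A m * aw A m) - l ^ 2 * (∑ m ∈ M, ∑ k ∈ M, aw A m * aw A k)) ≤
    ∑ᶠ n ∈ {n | n ∈ Sset 1 x ∧ omegaN n = r},
          sSup {t : ℝ | ∃ y ∈ Yset α x, t = (tauN (nsmall n y) : ℝ) / LLog y} / n := by
  have hLL : ∀ y, 1 ≤ LLog y := fun y => le_max_left _ _
  have hfin : {n | n ∈ Sset 1 x ∧ omegaN n = r}.Finite := (Sset_finite x).subset fun n hn => hn.1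
  have hnn : ∀ n, 0 ≤ sSup {t : ℝ | ∃ y ∈ Yset α x, t = (tauN (nsmall n y) : ℝ) / LLog y} := by
    intro n
    apply Real.sSup_nonneg
    rintro t ⟨y, _, rfl⟩
    have := hLL y
    positivity
  rw [finsum_mem_eq_finite_toFinset_sum _ hfin]
  have hprime : ∀ A ∈ (Tset x).powersetCard r, ∀ p ∈ A, p.Prime := fun A hA p hp =>
    (tset_mem ((Finset.mem_powersetCard.1 hA).1 hp)).1
  have hinj : Set.InjOn (fun A : Finset ℕ => ∏ p ∈ A, p) ((Tset x).powersetCard r) := by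
    intro A hA B hB h
    rw [← Nat.primeFactors_prod (hprime A hA), ← Nat.primeFactors_prod (hprime B hB)]
    exact congrArg _ h
  have hsub : ((Tset x).powersetCard r).image (fun A : Finset ℕ => ∏ p ∈ A, p) ⊆ hfin.toFinset := by
    intro n hn
    obtain ⟨A, hA, rfl⟩ := Finset.mem_image.1 hn
    rw [Set.Finite.mem_toFinset]
    have hpf := Nat.primeFactors_prod (hprime A hA)
    refine ⟨⟨Finset.prod_pos fun p hp => (hprime A hA p hp).pos, ?_, ?_⟩, ?_⟩
    · apply Finset.squarefree_prod_of_pairwise_isCoprime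
      · intro p hp q hq hpq
        rw [Function.onFun, ← Nat.coprime_iff_isRelPrime]
        exact (Nat.coprime_primes (hprime A hA p hp) (hprime A hA q hq)).2 hpq
      · intro p hp
        exact (hprime A hA p hp).prime.squarefree
    · intro p hp
      rw [hpf] at hp
      have := tset_mem ((Finset.mem_powersetCard.1 hA).1 hp)
      exact ⟨by exact_mod_cast this.1.one_le, this.2.2⟩
    · show (Nat.primeFactors _).card = r
      rw [hpf]; exact (Finset.mem_powersetCard.1 hA).2
  refine le_trans ?_ (Finset.sum_le_sum_of_subset_of_nonneg hsub fun n _ _ => div_nonneg (hnn n) (Nat.cast_nonneg n))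
  rw [Finset.sum_image hinj]
  refine Finset.sum_le_sum fun A hA => ?_
  have hpos : 0 < ∏ p ∈ A, p := Finset.prod_pos fun p hp => (hprime A hA p hp).pos
  have key := max_lin M (aw A) (aw_nonneg A) (sSup {t : ℝ | ∃ y ∈ Yset α x, t = (tauN (nsmall (∏ p ∈ A, p) y) : ℝ) / LLog y}) (hnn _) ?_ l hl
  · have e : ∏ p ∈ A, (1:ℝ) / p = 1 / ((∏ p ∈ A, p : ℕ) : ℝ) := by
      rw [Finset.prod_div_distrib]; simp
    rw [e, div_mul_eq_mul_div, one_mul]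
    gcongr
  · intro m hm
    apply le_csSup
    · refine ⟨tauN (∏ p ∈ A, p), ?_⟩
      rintro t ⟨y, _, rfl⟩
      have h1 : (tauN (nsmall (∏ p ∈ A, p) y) : ℝ) ≤ tauN (∏ p ∈ A, p) := by
        exact_mod_cast tau_nsmall_le _ hpos y
      exact (div_le_self (Nat.cast_nonneg _) (hLL y)).trans h1
    · refine ⟨_, (hM m hm).1, ?_⟩
      rw [aw_sq A (hprime A hA), (hM m hm).2]

lemma swap_sum (x : ℝ) (r m k : ℕ) :
    ∑ A ∈ (Tset x).powersetCard r, (∏ p ∈ A, (1:ℝ) / p) * (aw A m * aw A k) =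
      Esym r (Tset x) (fun p => bw m p * bw k p / p) / (√2 ^ m * √2 ^ k) := by
  unfold Esym aw
  rw [Finset.sum_div]
  refine Finset.sum_congr rfl fun A _ => ?_
  rw [Finset.prod_div_distrib, Finset.prod_div_distrib, Finset.prod_mul_distrib]
  simp only [Finset.prod_const_one]
  field_simp

lemma Zsum (x : ℝ) (m k : ℕ) (hmk : m ≤ k) (hk : Real.exp (2 ^ k) ≤ x) :
    ∑ p ∈ Tset x, bw m p * bw k p / p = Ssum x + (2 - √2) * Ssum (Real.exp (2 ^ m)) + (√2 - 1) * Ssum (Real.exp (2 ^ k)) := by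
  have hyk : Real.exp (2 ^ m) ≤ Real.exp (2 ^ k) := Real.exp_le_exp.2 (pow_le_pow_right₀ (by norm_num) hmk)
  have hT : ∀ y ≤ x, Ssum y = ∑ p ∈ Tset x, if (p:ℝ) < y then (1:ℝ)/p else 0 := by
    intro y hy
    rw [Ssum, ← Finset.sum_filter]
    apply Finset.sum_congr _ (fun _ _ => rfl)
    ext p
    simp only [Tset, Finset.mem_filter, Finset.mem_range, Nat.lt_ceil]
    constructor
    · rintro ⟨h1, h2⟩; exact ⟨⟨h1.trans_le hy, h2⟩, h1⟩
    · rintro ⟨⟨_, h2⟩, h1⟩; exact ⟨h1, h2⟩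
  rw [hT _ hk, hT _ (hyk.trans hk), Ssum, Finset.mul_sum, Finset.mul_sum, ← Finset.sum_add_distrib, ← Finset.sum_add_distrib]
  refine Finset.sum_congr rfl fun p _ => ?_
  unfold bw
  have h2 : √2 * √2 = (2:ℝ) := Real.mul_self_sqrt (by norm_num)
  split_ifs with h1 h3 h3
  · rw [h2]; ring
  · exact absurd (h1.trans_le hyk) h3
  · ring
  · ring

lemma bw_sq_sum (x : ℝ) (m : ℕ) : ∑ p ∈ Tset x, (bw m p * bw m p / p) ^ 2 ≤ 1 / 4 := by
  have tel : ∀ N : ℕ, ∑ p ∈ (Finset.range N).filter (fun p => 20 ≤ p), 4 / (p:ℝ) ^ 2 ≤ 4 / 19 - (if 20 ≤ N then 4 / ((N:ℝ) - 1) else 4 / 19) := by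
    intro N
    induction N with
    | zero => simp
    | succ N ih =>
      rw [Finset.range_add_one, Finset.filter_insert]
      split_ifs at ih ⊢ with h1 h2 h2 
      all_goals first
        | omega
        | skip
      · rw [Finset.sum_insert (by simp)]
        have : (20:ℝ) ≤ N := by exact_mod_cast h1
        have e : 4 / (N:ℝ) ^ 2 ≤ 4 / ((N:ℝ) - 1) - 4 / N := by
          rw [div_sub_div _ _ (by linarith) (by linarith), div_le_div_iff₀ (by positivity) (by nlinarith)]
          nlinarith
        push_cast
        rw [add_sub_cancel_right]
        linarith
      · have : N = 19 := by omega
        subst this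
        norm_num at ih ⊢
        linarith
  have h : ∑ p ∈ Tset x, (bw m p * bw m p / p) ^ 2 ≤ ∑ p ∈ (Finset.range ⌈x⌉₊).filter (fun p => 20 ≤ p), 4 / (p:ℝ) ^ 2 := by
    refine le_trans (Finset.sum_le_sum (g := fun p : ℕ => 4 / (p:ℝ)^2) fun p _ => ?_) (Finset.sum_le_sum_of_subset_of_nonneg ?_ fun _ _ _ => by positivity)
    · rw [div_pow]
      gcongr
      have h2 : √2 * √2 = (2:ℝ) := Real.mul_self_sqrt (by norm_num)
      unfold bw; split_ifs
      · rw [h2]; norm_num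
      · norm_num
    · intro p hp
      simp only [Tset, Finset.mem_filter] at hp ⊢
      exact ⟨hp.1, hp.2.2⟩
  refine h.trans ((tel _).trans ?_)
  split_ifs with h1
  · have : (20:ℝ) ≤ ⌈x⌉₊ := by exact_mod_cast h1
    have : 0 ≤ 4 / ((⌈x⌉₊:ℝ) - 1) := div_nonneg (by norm_num) (by linarith)
    linarith
  · norm_num

lemma primeProd_ge (x : ℝ) : Real.exp (-∑ p ∈ (Finset.range ⌈x⌉₊).filter Nat.Prime, (1:ℝ) / p) ≤ primeProd 1 x := by
  unfold primeProd
  have e : {p : ℕ | p.Prime ∧ (1:ℝ) ≤ (p : ℝ) ∧ (p : ℝ) < x} = ((Finset.range ⌈x⌉₊).filter Nat.Prime : Finset ℕ) := by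
    ext p
    simp only [Set.mem_ofPred_eq, Finset.coe_filter, Finset.mem_range, Nat.lt_ceil]
    constructor
    · rintro ⟨h1, _, h2⟩; exact ⟨h2, h1⟩
    · rintro ⟨h1, h2⟩; exact ⟨h2, by exact_mod_cast h2.one_le, h1⟩
  rw [e, finprod_mem_coe_finset, ← Finset.sum_neg_distrib, Real.exp_sum]
  refine Finset.prod_le_prod (fun _ _ => (Real.exp_pos _).le) fun p _ => ?_
  rw [Real.exp_neg]
  apply inv_anti₀ (by positivity)
  linarith [Real.add_one_le_exp ((1:ℝ)/p)]

lemma geo_sum (ρ : ℝ) (h0 : 0 < ρ) (h1 : ρ < 1) (M : Finset ℕ) (m : ℕ) :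
    ∑ k ∈ M, ρ ^ ((k - m) + (m - k)) ≤ 2 / (1 - ρ) := by
  have hg : ∀ s : Finset ℕ, ∑ i ∈ s, ρ ^ i ≤ 1 / (1 - ρ) := by
    intro s
    refine ((summable_geometric_of_lt_one h0.le h1).sum_le_tsum s (fun _ _ => by positivity)).trans ?_
    rw [tsum_geometric_of_lt_one h0.le h1, one_div]
  rw [← Finset.sum_filter_add_sum_filter_not M (fun k => m ≤ k)]
  have a : ∑ k ∈ M.filter (fun k => m ≤ k), ρ ^ ((k - m) + (m - k)) ≤ 1 / (1 - ρ) := by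
    refine le_trans (le_of_eq ?_) (hg ((M.filter (fun k => m ≤ k)).image (fun k => k - m)))
    rw [Finset.sum_image]
    · refine Finset.sum_congr rfl fun k hk => ?_
      have := (Finset.mem_filter.1 hk).2
      congr 1; omega
    · intro k hk j hj h
      have := (Finset.mem_filter.1 hk).2
      have := (Finset.mem_filter.1 hj).2
      simp only at h; omega
  have b : ∑ k ∈ M.filter (fun k => ¬ m ≤ k), ρ ^ ((k - m) + (m - k)) ≤ 1 / (1 - ρ) := by
    refine le_trans (le_of_eq ?_) (hg ((M.filter (fun k => ¬ m ≤ k)).image (fun k => m - k)))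
    rw [Finset.sum_image]
    · refine Finset.sum_congr rfl fun k hk => ?_
      have := (Finset.mem_filter.1 hk).2
      congr 1; omega
    · intro k hk j hj h
      have := (Finset.mem_filter.1 hk).2
      have := (Finset.mem_filter.1 hj).2
      simp only at h; omega
  have : 2 / (1 - ρ) = 1 / (1 - ρ) + 1 / (1 - ρ) := by ring
  linarith


lemma sqrt_two_pow (m : ℕ) : √2 ^ m = Real.exp (m * Real.log 2 / 2) := by
  have : √2 = Real.exp (Real.log 2 / 2) := by
    rw [Real.exp_half, Real.exp_log (by norm_num)]
  rw [this, ← Real.exp_nat_mul]; congr 1; ring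

lemma loglog_y (m : ℕ) : Real.log (Real.log (Real.exp (2 ^ m))) = m * Real.log 2 := by
  rw [Real.log_exp, Real.log_pow]

lemma three_le_y (m : ℕ) (hm : 1 ≤ m) : 3 ≤ Real.exp (2 ^ m) := by
  have h1 : (2:ℝ) ≤ 2 ^ m := by
    calc (2:ℝ) = 2 ^ 1 := by norm_num
      _ ≤ _ := pow_le_pow_right₀ (by norm_num) hm
  linarith [Real.add_one_le_exp ((2:ℝ) ^ m)]

noncomputable def rho : ℝ := Real.exp (-(Real.log 2 * (3 / 2 - √2)))

lemma rho_lt : rho < 1 := by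
  unfold rho
  rw [Real.exp_lt_one_iff]
  have h1 : √2 < 3 / 2 := by
    rw [Real.sqrt_lt' (by norm_num)]; norm_num
  have h2 : 0 < Real.log 2 := Real.log_pos (by norm_num)
  have := mul_pos h2 (sub_pos.2 h1)
  linarith

noncomputable def Xmk (x : ℝ) (r m k : ℕ) : ℝ :=
  Esym r (Tset x) (fun p => bw m p * bw k p / p) / (√2 ^ m * √2 ^ k)

lemma Xmk_symm (x : ℝ) (r m k : ℕ) : Xmk x r m k = Xmk x r k m := by
  unfold Xmk
  rw [mul_comm]
  congr 2
  funext p; rw [mul_comm (bw m p)]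

/-- Hypothesis packaging of Mertens. -/
def MertC (C : ℝ) : Prop := 0 ≤ C ∧ ∀ y : ℝ, 3 ≤ y →
    |(∑ p ∈ (Finset.range ⌈y⌉₊).filter Nat.Prime, (1:ℝ) / p) - Real.log (Real.log y)| ≤ C ∧ 
    |Ssum y - Real.log (Real.log y)| ≤ C

lemma Zest (C : ℝ) (hC : MertC C) (x : ℝ) (hx : 3 ≤ x) (m k : ℕ) (hm : 1 ≤ m) (hmk : m ≤ k) (hk : Real.exp (2 ^ k) ≤ x) :
    |(∑ p ∈ Tset x, bw m p * bw k p / p) - (Real.log (Real.log x) + (2 - √2) * (m * Real.log 2) + (√2 - 1) * (k * Real.log 2))| ≤ 2 * C := by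
  rw [Zsum x m k hmk hk]
  have h1 := abs_le.1 (hC.2 x hx).2
  have h2 := abs_le.1 (hC.2 _ (three_le_y m hm)).2
  have h3 := abs_le.1 (hC.2 _ (three_le_y k (hm.trans hmk))).2
  rw [loglog_y] at h2 h3
  have s1 : 0 ≤ √2 - 1 := by
    rw [sub_nonneg]; exact Real.one_le_sqrt.2 (by norm_num)
  have s2 : 0 ≤ 2 - √2 := by
    rw [sub_nonneg, Real.sqrt_le_left (by norm_num)]; norm_num
  have a1 := mul_le_mul_of_nonneg_left h2.1 s2
  have a2 := mul_le_mul_of_nonneg_left h2.2 s2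
  have a3 := mul_le_mul_of_nonneg_left h3.1 s1
  have a4 := mul_le_mul_of_nonneg_left h3.2 s1
  rw [abs_le]
  constructor <;> linarith

lemma zz_nonneg (m k : ℕ) (p : ℕ) : 0 ≤ bw m p * bw k p / (p:ℝ) :=
  div_nonneg (mul_nonneg (bw_pos _ _).le (bw_pos _ _).le) (Nat.cast_nonneg _)

lemma X_upper_aux (C : ℝ) (hC : MertC C) (x : ℝ) (hx : 3 ≤ x) (r : ℕ) (hr : 1 ≤ r) (m k : ℕ) (hm : 1 ≤ m) (hmk : m ≤ k) (hk : Real.exp (2 ^ k) ≤ x) :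
    Xmk x r m k ≤ Real.exp (2 * C) * (Real.exp (Real.log (Real.log x)) / √r) * rho ^ ((k - m) + (m - k)) := by
  have hr' : (0:ℝ) < r := by exact_mod_cast hr
  have hz := (abs_le.1 (Zest C hC x hx m k hm hmk hk)).2
  have h := Esym_le_exp (Tset x) (fun p => bw m p * bw k p / p) (zz_nonneg m k) r hr
  unfold Xmk
  rw [sqrt_two_pow, sqrt_two_pow, rho, ← Real.exp_nat_mul, ← Real.exp_add, div_le_iff₀ (Real.exp_pos _)]
  refine h.trans ?_
  have e : ((k - m + (m - k) : ℕ) : ℝ) = (k:ℝ) - m := by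
    have : k - m + (m - k) = k - m := by omega
    rw [this, Nat.cast_sub hmk]
  rw [e, mul_div_assoc', ← Real.exp_add, div_mul_eq_mul_div, div_mul_eq_mul_div, ← Real.exp_add, ← Real.exp_add]
  gcongr
  linarith

lemma X_upper (C : ℝ) (hC : MertC C) (x : ℝ) (hx : 3 ≤ x) (r : ℕ) (hr : 1 ≤ r) (m k : ℕ) (hm : 1 ≤ m) (hk : 1 ≤ k)
    (hm' : Real.exp (2 ^ m) ≤ x) (hk' : Real.exp (2 ^ k) ≤ x) :
    Xmk x r m k ≤ Real.exp (2 * C) * (Real.exp (Real.log (Real.log x)) / √r) * rho ^ ((k - m) + (m - k)) := by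
  rcases le_total m k with h | h
  · exact X_upper_aux C hC x hx r hr m k hm h hk'
  · rw [Xmk_symm, add_comm]
    exact X_upper_aux C hC x hx r hr k m hk h hm'

lemma X_lower (C K : ℝ) (hC : MertC C) (x : ℝ) (hx : 3 ≤ x) (r : ℕ) (hr : 1 ≤ r) (m : ℕ) (hm : 1 ≤ m)
    (hm' : Real.exp (2 ^ m) ≤ x)
    (h1 : |Real.log (Real.log x) + m * Real.log 2 - r| + 2 * C ≤ r / 2)
    (h2 : 2 * (|Real.log (Real.log x) + m * Real.log 2 - r| + 2 * C) ^ 2 ≤ K * r) :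
    1 / 2 * Real.exp (-(2 * C) - K - 1) * (Real.exp (Real.log (Real.log x)) / √r) ≤ Xmk x r m m := by
  have hr' : (0:ℝ) < r := by exact_mod_cast hr
  have hz := Zest C hC x hx m m hm le_rfl hm'
  set Z := ∑ p ∈ Tset x, bw m p * bw m p / p with hZ
  have e : Real.log (Real.log x) + (2 - √2) * (m * Real.log 2) + (√2 - 1) * (m * Real.log 2) = Real.log (Real.log x) + m * Real.log 2 := by ring
  rw [e] at hz
  have hd : |Z - r| ≤ |Real.log (Real.log x) + m * Real.log 2 - r| + 2 * C := by
    have := abs_sub_le Z (Real.log (Real.log x) + m * Real.log 2) r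
    linarith
  have hd2 : (Z - r) ^ 2 ≤ (|Real.log (Real.log x) + m * Real.log 2 - r| + 2 * C) ^ 2 := by
    rw [← sq_abs (Z - r)]; gcongr
  have h := Esym_ge_exp (Tset x) (fun p => bw m p * bw m p / p) (zz_nonneg m m) r hr K (bw_sq_sum x m) (hd.trans h1) (by linarith)
  unfold Xmk
  rw [sqrt_two_pow, ← Real.exp_add, le_div_iff₀ (Real.exp_pos _)]
  refine le_trans ?_ h
  have hz1 := (abs_le.1 hz).1
  have e2 : 1 / 2 * Real.exp (-(2 * C) - K - 1) * (Real.exp (Real.log (Real.log x)) / √r) * Real.exp (m * Real.log 2 / 2 + m * Real.log 2 / 2)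
      = 1 / 2 * (Real.exp ((-(2 * C) - K - 1) + Real.log (Real.log x) + (m * Real.log 2 / 2 + m * Real.log 2 / 2)) / √r) := by
    rw [Real.exp_add (_ + _) (_ + _), Real.exp_add (-(2 * C) - K - 1)]; ring
  rw [e2]
  have e3 : Real.exp ((-(2 * C) - K - 1) + Real.log (Real.log x) + (m * Real.log 2 / 2 + m * Real.log 2 / 2)) ≤ Real.exp (Z - K - 1) := by
    apply Real.exp_le_exp.2; linarith
  exact mul_le_mul_of_nonneg_left (div_le_div_of_nonneg_right e3 (Real.sqrt_nonneg _)) (by norm_num)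

set_option maxHeartbeats 2000000 in
theorem statement9 (ε : ℝ) (hε : 0 < ε) (hε' : ε < 1/2) :
    ∃ c : ℝ, 0 < c ∧ ∃ x₀ : ℝ, ∀ x : ℝ, x₀ ≤ x → ∀ r : ℕ,
      (1 + ε) * LLog2 x ≤ r → (r : ℝ) ≤ (2 - ε) * LLog2 x →
      c ≤ primeProd 1 x * ∑ᶠ n ∈ {n | n ∈ Sset 1 x ∧ omegaN n = r},
          sSup {t : ℝ | ∃ y ∈ Yset ((r : ℝ) / LLog2 x - 1) x,
              t = (tauN (nsmall n y) : ℝ) / LLog y} / n := by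
  obtain ⟨C, hC⟩ : ∃ C, MertC C := mertens3
  have hC0 := hC.1
  obtain ⟨K, hK⟩ : ∃ K : ℝ, K = 4 + 16 * C ^ 2 := ⟨_, rfl⟩
  obtain ⟨c1, hc1⟩ : ∃ c1 : ℝ, c1 = 1 / 2 * Real.exp (-(2 * C) - K - 1) := ⟨_, rfl⟩
  obtain ⟨C2, hC2⟩ : ∃ C2 : ℝ, C2 = Real.exp (2 * C) * (2 / (1 - rho)) := ⟨_, rfl⟩
  have hc1p : 0 < c1 := by rw [hc1]; positivity
  have hrho := rho_lt
  have hrho0 : 0 < rho := Real.exp_pos _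
  have hC2p : 0 < C2 := by
    rw [hC2]; exact mul_pos (Real.exp_pos _) (div_pos (by norm_num) (by linarith))
  refine ⟨Real.exp (-C) * (c1 ^ 2 / C2 / 2), by positivity, Real.exp (Real.exp (4 / ε ^ 2 + 8 * C + 1)), ?_⟩
  intro x hx r hr1 hr2
  have hq : 0 < 4 / ε ^ 2 := by positivity
  have hxpos : 0 < x := (Real.exp_pos _).trans_le hx
  have hlx : Real.exp (4 / ε ^ 2 + 8 * C + 1) ≤ Real.log x := (Real.le_log_iff_exp_le hxpos).2 hx
  have hlxpos : 0 < Real.log x := (Real.exp_pos _).trans_le hlx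
  have hllx : 4 / ε ^ 2 + 8 * C + 1 ≤ Real.log (Real.log x) := (Real.le_log_iff_exp_le hlxpos).2 hlx
  have hlx1 : 1 ≤ Real.log x := by
    have := Real.add_one_le_exp (4 / ε ^ 2 + 8 * C + 1)
    linarith
  have hLL : LLog2 x = Real.log (Real.log x) := by
    unfold LLog2 LLog
    rw [max_eq_right hlx1, max_eq_right (by linarith)]
  obtain ⟨L, hL⟩ : ∃ L, Real.log (Real.log x) = L := ⟨_, rfl⟩
  have hexpL : Real.exp L = Real.log x := by rw [← hL, Real.exp_log hlxpos]
  have hx3 : 3 ≤ x := by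
    have := Real.add_one_le_exp (Real.exp (4 / ε ^ 2 + 8 * C + 1))
    have := Real.add_one_le_exp (4 / ε ^ 2 + 8 * C + 1)
    linarith
  rw [hL] at hLL hllx
  rw [hLL] at hr1 hr2 ⊢
  have hL1 : 1 ≤ L := by linarith
  have hLpos : 0 < L := by linarith
  have hsq : √L ^ 2 = L := Real.sq_sqrt hLpos.le
  have hsq1 : 1 ≤ √L := Real.one_le_sqrt.2 hL1
  have hsqε : √L ≤ ε / 2 * L := by
    have h1 : 4 / ε ^ 2 ≤ √L ^ 2 := by linarith
    rw [div_le_iff₀ (by positivity)] at h1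
    have h2 : 2 ≤ √L * ε := by
      by_contra hcon
      push Not at hcon
      have : 0 ≤ √L * ε := by positivity
      nlinarith
    calc √L = √L * 2 / 2 := by ring
      _ ≤ √L * (√L * ε) / 2 := by gcongr
      _ = ε / 2 * √L ^ 2 := by ring
      _ = _ := by rw [hsq]
  have hεL : 4 ≤ ε * L := by
    have h1 : 4 / ε ^ 2 ≤ L := by linarith
    rw [div_le_iff₀ (by positivity)] at h1
    have : L * ε ^ 2 = (ε * L) * ε := by ring
    nlinarith
  have hrL : L ≤ r := by linarith
  have hr1' : 1 ≤ r := by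
    have : (1:ℝ) ≤ r := by linarith
    exact_mod_cast this
  have hα : ((r:ℝ) / L - 1) * L = r - L := by field_simp
  have hlog2 : 0 < Real.log 2 := Real.log_pos (by norm_num)
  have hlog2' : Real.log 2 < 1 := by linarith [Real.log_two_lt_d9]
  obtain ⟨M, hM⟩ : ∃ M, M = Finset.Icc ⌈(r - L - √L) / Real.log 2⌉₊ ⌊(r - L + √L) / Real.log 2⌋₊ := ⟨_, rfl⟩
  have hMm : ∀ m ∈ M, r - L - √L ≤ m * Real.log 2 ∧ m * Real.log 2 ≤ r - L + √L := by
    intro m hm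
    rw [hM, Finset.mem_Icc, Nat.ceil_le, Nat.le_floor_iff (div_nonneg (by linarith) hlog2.le), div_le_iff₀ hlog2, le_div_iff₀ hlog2] at hm
    exact hm
  have hMcard : √L ≤ M.card := by
    rw [hM, Nat.card_Icc]
    have a1 := Nat.lt_floor_add_one ((r - L + √L) / Real.log 2)
    have a2 := Nat.ceil_lt_add_one (a := (r - L - √L) / Real.log 2) (div_nonneg (by linarith) hlog2.le)
    have a3 : ((⌊(r - L + √L) / Real.log 2⌋₊ + 1 : ℕ) : ℝ) ≤ (⌊(r - L + √L) / Real.log 2⌋₊ + 1 - ⌈(r - L - √L) / Real.log 2⌉₊ : ℕ) + (⌈(r - L - √L) / Real.log 2⌉₊ : ℕ) := by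
      rw [← Nat.cast_add]
      exact_mod_cast (le_tsub_add : ⌊(r - L + √L) / Real.log 2⌋₊ + 1 ≤ _ - ⌈(r - L - √L) / Real.log 2⌉₊ + ⌈(r - L - √L) / Real.log 2⌉₊)
    push_cast at a3
    have a4 : (r - L + √L) / Real.log 2 - (r - L - √L) / Real.log 2 = 2 * √L / Real.log 2 := by ring
    have a5 : 2 * √L ≤ 2 * √L / Real.log 2 := le_div_self (by positivity) hlog2 hlog2'.le
    linarith
  have hM1 : ∀ m ∈ M, 1 ≤ m := by
    intro m hm
    by_contra h0
    have : m = 0 := by omega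
    subst this
    have := (hMm 0 hm).1
    simp at this
    linarith
  have hMx : ∀ m ∈ M, Real.exp (2 ^ m) ≤ x := by
    intro m hm
    rw [← Real.le_log_iff_exp_le hxpos, ← hexpL]
    have : (2:ℝ) ^ m = Real.exp (m * Real.log 2) := by
      rw [Real.exp_nat_mul, Real.exp_log (by norm_num)]
    rw [this]
    apply Real.exp_le_exp.2
    linarith [(hMm m hm).2]
  have hMY : ∀ m ∈ M, Real.exp (2 ^ m) ∈ Yset ((r:ℝ) / L - 1) x ∧ LLog (Real.exp (2 ^ m)) = 2 ^ m := by
    intro m hm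
    have e1 : LLog (Real.exp (2 ^ m)) = 2 ^ m := by
      unfold LLog
      rw [Real.log_exp, max_eq_right (one_le_pow₀ (by norm_num))]
    have e2 : LLog2 (Real.exp (2 ^ m)) = m * Real.log 2 := by
      unfold LLog2
      rw [e1, LLog, Real.log_pow, max_eq_right]
      linarith [(hMm m hm).1]
    refine ⟨⟨Real.exp_pos _, ?_, m, by rw [e2]; simp⟩, e1⟩
    rw [e2, hLL, hα, abs_le]
    have := hMm m hm
    constructor <;> linarith
  have hl0 : 0 ≤ c1 / C2 := by positivity
  have red := reduction x ((r:ℝ) / L - 1) r M hMY (c1 / C2) hl0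
  obtain ⟨B, hB⟩ : ∃ B : ℝ, B = Real.exp L / √r := ⟨_, rfl⟩
  have hrpos : (0:ℝ) < r := by linarith
  have hBp : 0 < B := by rw [hB]; positivity
  have eqn : ∑ A ∈ (Tset x).powersetCard r, (∏ p ∈ A, (1:ℝ) / p) *
      (2 * (c1 / C2) * (∑ m ∈ M, aw A m * aw A m) - (c1 / C2) ^ 2 * (∑ m ∈ M, ∑ k ∈ M, aw A m * aw A k)) =
      2 * (c1 / C2) * (∑ m ∈ M, Xmk x r m m) - (c1 / C2) ^ 2 * (∑ m ∈ M, ∑ k ∈ M, Xmk x r m k) := by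
    unfold Xmk
    simp_rw [← swap_sum, mul_sub, Finset.sum_sub_distrib]
    congr 1
    · rw [Finset.sum_comm, Finset.mul_sum]
      refine Finset.sum_congr rfl fun A _ => ?_
      rw [← Finset.mul_sum]; ring
    · have : ∀ m, ∑ k ∈ M, ∑ A ∈ (Tset x).powersetCard r, (∏ p ∈ A, (1:ℝ) / p) * (aw A m * aw A k) = ∑ A ∈ (Tset x).powersetCard r, (∏ p ∈ A, (1:ℝ) / p) * ∑ k ∈ M, (aw A m * aw A k) := by
        intro m
        rw [Finset.sum_comm]
        refine Finset.sum_congr rfl fun A _ => ?_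
        rw [← Finset.mul_sum]
      simp_rw [this]
      rw [Finset.sum_comm, Finset.mul_sum]
      refine Finset.sum_congr rfl fun A _ => ?_
      rw [← Finset.mul_sum]; ring
  rw [eqn] at red
  have low : M.card * (c1 * B) ≤ ∑ m ∈ M, Xmk x r m m := by
    rw [← nsmul_eq_mul, ← Finset.sum_const]
    refine Finset.sum_le_sum fun m hm => ?_
    have hd : |L + m * Real.log 2 - r| ≤ √L := by
      rw [abs_le]
      have := hMm m hm
      constructor <;> linarith
    have := X_lower C K hC x hx3 r hr1' m (hM1 m hm) (hMx m hm) (by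
      rw [hL]
      have : √L ≤ L / 4 := by nlinarith
      linarith) (by
      rw [hL, hK]
      calc 2 * (|L + m * Real.log 2 - r| + 2 * C) ^ 2 ≤ 2 * (√L + 2 * C) ^ 2 := by gcongr
        _ ≤ 4 * √L ^ 2 + 16 * C ^ 2 * 1 := by nlinarith [sq_nonneg (√L - 2 * C)]
        _ ≤ 4 * r + 16 * C ^ 2 * r := by
          rw [hsq]; gcongr; linarith
        _ = _ := by ring)
    rw [hL, ← hc1, ← hB] at this
    exact this
  have upp : ∑ m ∈ M, ∑ k ∈ M, Xmk x r m k ≤ M.card * (C2 * B) := by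
    rw [← nsmul_eq_mul, ← Finset.sum_const]
    refine Finset.sum_le_sum fun m hm => ?_
    calc ∑ k ∈ M, Xmk x r m k ≤ ∑ k ∈ M, Real.exp (2 * C) * B * rho ^ ((k - m) + (m - k)) := by
          refine Finset.sum_le_sum fun k hk => ?_
          have := X_upper C hC x hx3 r hr1' m k (hM1 m hm) (hM1 k hk) (hMx m hm) (hMx k hk)
          rw [hL, ← hB] at this
          exact this
      _ = Real.exp (2 * C) * B * ∑ k ∈ M, rho ^ ((k - m) + (m - k)) := by rw [Finset.mul_sum]
      _ ≤ Real.exp (2 * C) * B * (2 / (1 - rho)) := by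
          gcongr
          exact geo_sum rho hrho0 hrho M m
      _ = _ := by rw [hC2]; ring
  have tot : M.card * B * (c1 ^ 2 / C2) ≤ 2 * (c1 / C2) * (∑ m ∈ M, Xmk x r m m) - (c1 / C2) ^ 2 * (∑ m ∈ M, ∑ k ∈ M, Xmk x r m k) := by
    have a1 := mul_le_mul_of_nonneg_left low (by positivity : 0 ≤ 2 * (c1 / C2))
    have a2 := mul_le_mul_of_nonneg_left upp (by positivity : 0 ≤ (c1 / C2) ^ 2)
    have e : 2 * (c1 / C2) * (M.card * (c1 * B)) - (c1 / C2) ^ 2 * (M.card * (C2 * B)) = M.card * B * (c1 ^ 2 / C2) := by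
      field_simp; ring
    linarith
  have hMB : Real.exp L / 2 ≤ M.card * B := by
    rw [hB, mul_div_assoc', div_le_div_iff₀ (by norm_num) (by positivity)]
    have : √(r:ℝ) ≤ 2 * √L := by
      rw [Real.sqrt_le_left (by positivity), mul_pow, hsq]; nlinarith
    calc Real.exp L * √r ≤ Real.exp L * (2 * √L) := by gcongr
      _ ≤ Real.exp L * (2 * M.card) := by gcongr
      _ = _ := by ring
  have hS : Real.exp L / 2 * (c1 ^ 2 / C2) ≤ M.card * B * (c1 ^ 2 / C2) :=
    mul_le_mul_of_nonneg_right hMB (div_nonneg (sq_nonneg _) hC2p.le)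
  have hfin := (hS.trans tot).trans red
  have hpp : Real.exp (-L - C) ≤ primeProd 1 x := by
    refine le_trans ?_ (primeProd_ge x)
    apply Real.exp_le_exp.2
    have := (abs_le.1 (hC.2 x hx3).1).2
    rw [hL] at this
    linarith
  calc Real.exp (-C) * (c1 ^ 2 / C2 / 2) = Real.exp (-L - C) * (Real.exp L / 2 * (c1 ^ 2 / C2)) := by
        have : Real.exp (-C) = Real.exp (-L - C) * Real.exp L := by rw [← Real.exp_add]; congr 1; ring
        rw [this]; ring
    _ ≤ _ := mul_le_mul hpp hfin (by positivity) ((Real.exp_pos _).le.trans hpp)
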